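/- Let L : ℝ[x₁,…,x_s] → ℝ be linear with L(1)=1. Then L is a moment functional on the closed unit ball B^s ⊂ ℝ^s if and only if L is positive semidefinite and v_L(x₁² + ⋯ + x_s²) ≤ 1. -/

import Mathlib

open MeasureTheory MvPolynomial

/-- The set of ratios `L(a^{2n+2})/L(a^{2n})` over `n` with `L(a^{2n}) ≠ 0`. -/
def ratioSet {A : Type*} [CommRing A] [Algebra ℝ A] (L : A →ₗ[ℝ] ℝ) (a : A) : Set ℝ :=
  {r | ∃ n : ℕ, L (a ^ (2 * n)) ≠ 0 ∧ r = L (a ^ (2 * n + 2)) / L (a ^ (2 * n))}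

namespace BallMoment

variable {s : ℕ}

/-- The squared norm polynomial. -/
noncomputable def nsq (s : ℕ) : MvPolynomial (Fin s) ℝ := ∑ i, X i ^ 2

/-- Positivity together with boundedness by one of the squared norm. -/
def QPos (f : MvPolynomial (Fin s) ℝ →ₗ[ℝ] ℝ) : Prop :=
  (∀ P, 0 ≤ f (P ^ 2)) ∧ ∀ P, f (nsq s * P ^ 2) ≤ f (P ^ 2)

theorem cs (f : MvPolynomial (Fin s) ℝ →ₗ[ℝ] ℝ) (h : ∀ P, 0 ≤ f (P ^ 2))
    (p q : MvPolynomial (Fin s) ℝ) : f (p * q) ^ 2 ≤ f (p ^ 2) * f (q ^ 2) := by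
  have key : ∀ t : ℝ, 0 ≤ f (p ^ 2) * (t * t) + (2 * f (p * q)) * t + f (q ^ 2) := by
    intro t
    have h2 := h (t • p + q)
    have e : (t • p + q) ^ 2 = (t * t) • p ^ 2 + (2 * t) • (p * q) + q ^ 2 := by
      simp only [smul_eq_C_mul, map_mul, map_ofNat]; ring
    rw [e] at h2
    simp only [map_add, map_smul, smul_eq_mul] at h2
    linarith
  have := discrim_le_zero key
  unfold discrim at this
  nlinarith

theorem x_le (f : MvPolynomial (Fin s) ℝ →ₗ[ℝ] ℝ) (h : ∀ P, 0 ≤ f (P ^ 2)) (i : Fin s)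
    (P : MvPolynomial (Fin s) ℝ) : f (X i ^ 2 * P ^ 2) ≤ f (nsq s * P ^ 2) := by
  unfold nsq
  rw [Finset.sum_mul, map_sum]
  refine Finset.single_le_sum (f := fun j => f (X j ^ 2 * P ^ 2)) ?_ (Finset.mem_univ i)
  intro j _
  have := h (X j * P)
  rwa [mul_pow] at this

theorem two_add (f : MvPolynomial (Fin s) ℝ →ₗ[ℝ] ℝ) (h : ∀ P, 0 ≤ f (P ^ 2))
    (y : MvPolynomial (Fin s) ℝ) (hy : ∀ P, f (y ^ 2 * P ^ 2) ≤ f (P ^ 2))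
    (P : MvPolynomial (Fin s) ℝ) : f (P ^ 2) ≤ f ((2 + y) * P ^ 2) := by
  have h1 := h ((1 + y) * P)
  have h2 := hy P
  have h3 := h P
  have e : (2 : ℝ) • ((2 + y) * P ^ 2) =
      ((1 + y) * P) ^ 2 + (3 : ℝ) • P ^ 2 - y ^ 2 * P ^ 2 := by
    simp only [smul_eq_C_mul, map_ofNat]; ring
  have e2 := congrArg f e
  simp only [map_add, map_sub, map_smul, smul_eq_mul] at e2
  linarith

theorem QPos.one_sub {f : MvPolynomial (Fin s) ℝ →ₗ[ℝ] ℝ} (h : QPos f) :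
    QPos (f ∘ₗ LinearMap.mulLeft ℝ (1 - nsq s)) := by
  constructor
  · intro P
    have := h.2 P
    simp only [LinearMap.comp_apply, LinearMap.mulLeft_apply, sub_mul, one_mul, map_sub]
    linarith
  · intro P
    have := h.1 ((1 - nsq s) * P)
    have e : ((1 - nsq s) * P) ^ 2 = (1 - nsq s) * P ^ 2 - (1 - nsq s) * (nsq s * P ^ 2) := by ring
    rw [e, map_sub] at this
    simp only [LinearMap.comp_apply, LinearMap.mulLeft_apply]
    linarith

theorem QPos.two_add {f : MvPolynomial (Fin s) ℝ →ₗ[ℝ] ℝ} (h : QPos f)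
    {y : MvPolynomial (Fin s) ℝ} {i : Fin s} (hy : y ^ 2 = X i ^ 2)
    (P : MvPolynomial (Fin s) ℝ) : f (P ^ 2) ≤ f ((2 + y) * P ^ 2) :=
  BallMoment.two_add f h.1 y (fun P => by rw [hy]; exact (x_le f h.1 i P).trans (h.2 P)) P

theorem QPos.mul_two_add {f : MvPolynomial (Fin s) ℝ →ₗ[ℝ] ℝ} (h : QPos f)
    {y : MvPolynomial (Fin s) ℝ} {i : Fin s} (hy : y ^ 2 = X i ^ 2) :
    QPos (f ∘ₗ LinearMap.mulLeft ℝ (2 + y)) := by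
  constructor
  · intro P
    exact (h.1 P).trans (h.two_add hy P)
  · intro P
    have h1 := (h.one_sub.1 P).trans (h.one_sub.two_add hy P)
    simp only [LinearMap.comp_apply, LinearMap.mulLeft_apply] at h1 ⊢
    have e : (1 - nsq s) * ((2 + y) * P ^ 2) = (2 + y) * P ^ 2 - (2 + y) * (nsq s * P ^ 2) := by
      ring
    rw [e, map_sub] at h1
    linarith

theorem bdd (p : MvPolynomial (Fin s) ℝ) : ∃ C : ℝ, 0 ≤ C ∧
    ∀ f : MvPolynomial (Fin s) ℝ →ₗ[ℝ] ℝ, QPos f → ∀ g, f (p ^ 2 * g ^ 2) ≤ C * f (g ^ 2) := by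
  induction p using MvPolynomial.induction_on with
  | C c =>
    refine ⟨c ^ 2, sq_nonneg c, fun f _ g => ?_⟩
    rw [← map_pow, ← smul_eq_C_mul, map_smul, smul_eq_mul]
  | add p q hp hq =>
    obtain ⟨A, hA, hp⟩ := hp
    obtain ⟨B, hB, hq⟩ := hq
    refine ⟨2 * A + 2 * B, by positivity, fun f hf g => ?_⟩
    have h1 := hp f hf g
    have h2 := hq f hf g
    have h3 := hf.1 ((p - q) * g)
    have e : (p + q) ^ 2 * g ^ 2 + ((p - q) * g) ^ 2 =
        (2 : ℝ) • (p ^ 2 * g ^ 2) + (2 : ℝ) • (q ^ 2 * g ^ 2) := by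
      simp only [smul_eq_C_mul, map_ofNat]; ring
    have e2 := congrArg f e
    simp only [map_add, map_smul, smul_eq_mul] at e2
    linarith
  | mul_X p i hp =>
    obtain ⟨A, hA, hp⟩ := hp
    refine ⟨A, hA, fun f hf g => ?_⟩
    have h1 := hp f hf g
    have h2 := (x_le f hf.1 i (p * g)).trans (hf.2 (p * g))
    rw [mul_pow p g] at h2
    rw [mul_pow, mul_comm (p ^ 2), mul_assoc]
    linarith

/-- The compact convex set of normalized functionals. -/
def state (s : ℕ) : Set (MvPolynomial (Fin s) ℝ → ℝ) :=
  {φ | (∀ p q, φ (p + q) = φ p + φ q) ∧ (∀ (c : ℝ) p, φ (c • p) = c * φ p) ∧ φ 1 = 1 ∧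
    (∀ P, 0 ≤ φ (P ^ 2)) ∧ ∀ P, φ (nsq s * P ^ 2) ≤ φ (P ^ 2)}

theorem mem_state_iff (φ : MvPolynomial (Fin s) ℝ → ℝ) :
    φ ∈ state s ↔ ∃ f : MvPolynomial (Fin s) ℝ →ₗ[ℝ] ℝ, QPos f ∧ f 1 = 1 ∧ ⇑f = φ := by
  constructor
  · rintro ⟨h1, h2, h3, h4, h5⟩
    exact ⟨{ toFun := φ, map_add' := h1, map_smul' := h2 }, ⟨h4, h5⟩, h3, rfl⟩
  · rintro ⟨f, hf, h1, rfl⟩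
    exact ⟨map_add f, fun c p => by simp, h1, hf.1, hf.2⟩

theorem isClosed_state : IsClosed (state s) := by
  have e (p : MvPolynomial (Fin s) ℝ) :
      Continuous fun φ : MvPolynomial (Fin s) ℝ → ℝ => φ p := continuous_apply p
  refine IsClosed.inter ?_ (IsClosed.inter ?_ (IsClosed.inter ?_ (IsClosed.inter ?_ ?_)))
  · show IsClosed {φ : MvPolynomial (Fin s) ℝ → ℝ | ∀ p q, φ (p + q) = φ p + φ q}
    simp only [Set.ofPred_forall]
    exact isClosed_iInter fun p => isClosed_iInter fun q =>
      isClosed_eq (e _) ((e _).add (e _))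
  · show IsClosed {φ : MvPolynomial (Fin s) ℝ → ℝ | ∀ (c : ℝ) p, φ (c • p) = c * φ p}
    simp only [Set.ofPred_forall]
    exact isClosed_iInter fun p => isClosed_iInter fun q =>
      isClosed_eq (e _) (continuous_const.mul (e _))
  · exact isClosed_eq (e 1) continuous_const
  · show IsClosed {φ : MvPolynomial (Fin s) ℝ → ℝ | ∀ P, 0 ≤ φ (P ^ 2)}
    simp only [Set.ofPred_forall]
    exact isClosed_iInter fun p => isClosed_le continuous_const (e _)
  · show IsClosed {φ : MvPolynomial (Fin s) ℝ → ℝ | ∀ P, φ (nsq s * P ^ 2) ≤ φ (P ^ 2)}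
    simp only [Set.ofPred_forall]
    exact isClosed_iInter fun p => isClosed_le (e _) (e _)

theorem isCompact_state : IsCompact (state s) := by
  choose C hC0 hC using bdd (s := s)
  refine IsCompact.of_isClosed_subset
    (isCompact_univ_pi (s := fun p => Set.Icc (-(C p + 1)) (C p + 1)) fun p => isCompact_Icc)
    isClosed_state ?_
  intro φ hφ p _
  obtain ⟨f, hf, h1, rfl⟩ := (mem_state_iff φ).1 hφ
  have h2 := hC p f hf 1
  have h3 := cs f hf.1 p 1
  simp only [one_pow, mul_one, h1] at h2 h3
  have h4 := hC0 p
  refine abs_le.1 ?_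
  apply abs_le_of_sq_le_sq _ (by positivity)
  nlinarith

theorem convex_state : Convex ℝ (state s) := by
  intro φ hφ ψ hψ a b ha hb hab
  obtain ⟨f, hf, h1, rfl⟩ := (mem_state_iff φ).1 hφ
  obtain ⟨g, hg, h2, rfl⟩ := (mem_state_iff ψ).1 hψ
  refine (mem_state_iff _).2 ⟨a • f + b • g, ⟨fun P => ?_, fun P => ?_⟩, ?_, ?_⟩
  · have := mul_nonneg ha (hf.1 P)
    have := mul_nonneg hb (hg.1 P)
    simp only [LinearMap.add_apply, LinearMap.smul_apply, smul_eq_mul]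
    linarith
  · have := mul_le_mul_of_nonneg_left (hf.2 P) ha
    have := mul_le_mul_of_nonneg_left (hg.2 P) hb
    simp only [LinearMap.add_apply, LinearMap.smul_apply, smul_eq_mul]
    linarith
  · simp [h1, h2, hab]
  · ext p; simp

theorem normalize {f : MvPolynomial (Fin s) ℝ →ₗ[ℝ] ℝ} (hf : QPos f) (h : 0 < f 1) :
    (fun p => (f 1)⁻¹ * f p) ∈ state s := by
  refine (mem_state_iff _).2 ⟨(f 1)⁻¹ • f, ⟨fun P => ?_, fun P => ?_⟩, ?_, ?_⟩
  · exact mul_nonneg (inv_nonneg.2 h.le) (hf.1 P)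
  · exact mul_le_mul_of_nonneg_left (hf.2 P) (inv_nonneg.2 h.le)
  · simp [h.ne']
  · ext p; simp

theorem extreme_mul {f : MvPolynomial (Fin s) ℝ →ₗ[ℝ] ℝ} (hf : QPos f) (h1 : f 1 = 1)
    (hext : ⇑f ∈ (state s).extremePoints ℝ) (i : Fin s) (p : MvPolynomial (Fin s) ℝ) :
    f (X i * p) = f (X i) * f p := by
  have ha := hf.two_add (y := X i) rfl 1
  have hb := hf.two_add (y := - X i) (neg_sq _) 1
  have hA := hf.mul_two_add (y := X i) rfl
  have hB := hf.mul_two_add (y := - X i) (neg_sq _)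
  have two (q : MvPolynomial (Fin s) ℝ) : f (2 * q) = 2 * f q := by
    rw [two_mul, map_add, two_mul]
  have two' : f 2 = 2 := by have := two 1; rwa [mul_one, h1, mul_one] at this
  simp only [one_pow, mul_one, h1, map_add, map_neg, two'] at ha hb
  have eA (q : MvPolynomial (Fin s) ℝ) :
      (f ∘ₗ LinearMap.mulLeft ℝ (2 + X i)) q = 2 * f q + f (X i * q) := by
    simp [add_mul, two]
  have eB (q : MvPolynomial (Fin s) ℝ) :
      (f ∘ₗ LinearMap.mulLeft ℝ (2 + - X i)) q = 2 * f q - f (X i * q) := by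
    simp [add_mul, two, sub_eq_add_neg]
  have nA := normalize hA (by rw [eA, h1, mul_one, mul_one]; linarith)
  have nB := normalize hB (by rw [eB, h1, mul_one, mul_one]; linarith)
  simp only [eA, h1, mul_one] at nA
  simp only [eB, h1, mul_one] at nB
  have pA : 0 < 2 + f (X i) := by linarith
  have pB : 0 < 2 - f (X i) := by linarith
  have := hext.2 nA nB ⟨(2 + f (X i)) / 4, (2 - f (X i)) / 4, by positivity, by positivity,
    by ring, by ext q; simp only [Pi.add_apply, Pi.smul_apply, smul_eq_mul]; field_simp; ring⟩
  have := congrFun this p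
  field_simp at this
  linarith

theorem extreme_eval {f : MvPolynomial (Fin s) ℝ →ₗ[ℝ] ℝ} (hf : QPos f) (h1 : f 1 = 1)
    (hext : ⇑f ∈ (state s).extremePoints ℝ) (p : MvPolynomial (Fin s) ℝ) :
    f p = eval (fun i => f (X i)) p := by
  induction p using MvPolynomial.induction_on with
  | C c =>
    have : (C c : MvPolynomial (Fin s) ℝ) = c • 1 := by rw [smul_eq_C_mul, mul_one]
    rw [eval_C, this, map_smul, h1, smul_eq_mul, mul_one]
  | add p q hp hq => rw [map_add, map_add, hp, hq]
  | mul_X p i hp => rw [mul_comm, extreme_mul hf h1 hext, map_mul, eval_X, hp]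

theorem nonneg_of_qpos {f : MvPolynomial (Fin s) ℝ →ₗ[ℝ] ℝ} (hf : QPos f) (h1 : f 1 = 1)
    (P : MvPolynomial (Fin s) ℝ) (hP : ∀ x : Fin s → ℝ, ∑ i, x i ^ 2 ≤ 1 → 0 ≤ eval x P) :
    0 ≤ f P := by
  have hmem : ⇑f ∈ state s := (mem_state_iff _).2 ⟨f, hf, h1, rfl⟩
  rw [← closure_convexHull_extremePoints isCompact_state convex_state] at hmem
  have hsub : closure (convexHull ℝ ((state s).extremePoints ℝ)) ⊆
      {φ : MvPolynomial (Fin s) ℝ → ℝ | 0 ≤ φ P} := by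
    refine closure_minimal (convexHull_min ?_ ?_)
      (isClosed_le continuous_const (continuous_apply P))
    · intro φ hφ
      obtain ⟨g, hg, hg1, rfl⟩ := (mem_state_iff φ).1 hφ.1
      show 0 ≤ g P
      rw [extreme_eval hg hg1 hφ]
      apply hP
      have h2 := hg.2 1
      rw [one_pow, mul_one, hg1, extreme_eval hg hg1 hφ] at h2
      simpa [nsq] using h2
    · intro φ hφ ψ hψ a b ha hb _
      exact add_nonneg (mul_nonneg ha hφ) (mul_nonneg hb hψ)
  exact hsub hmem

theorem qpos_of_ratio {L : MvPolynomial (Fin s) ℝ →ₗ[ℝ] ℝ} (h1 : L 1 = 1)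
    (h : ∀ P, 0 ≤ L (P ^ 2)) (hr : ∀ r ∈ ratioSet L (nsq s), r ≤ 1) : QPos L := by
  refine ⟨h, fun g => ?_⟩
  set a := nsq s with ha
  have hpow (n : ℕ) : 0 ≤ L (a ^ (2 * n)) := by rw [mul_comm, pow_mul]; exact h _
  have hb (n : ℕ) : L (a ^ (2 * n)) ≤ 1 := by
    induction n with
    | zero => simp [h1]
    | succ n ih =>
      by_cases h0 : L (a ^ (2 * n)) = 0
      · have h3 := cs L h (a ^ n) (a ^ (n + 2))
        have e1 : a ^ n * a ^ (n + 2) = a ^ (2 * (n + 1)) := by ring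
        have e2 : (a ^ n) ^ 2 = a ^ (2 * n) := by ring
        rw [e1, e2, h0, zero_mul] at h3
        nlinarith
      · have h3 := hr _ ⟨n, h0, rfl⟩
        have h4 : 0 < L (a ^ (2 * n)) := lt_of_le_of_ne (hpow n) (Ne.symm h0)
        rw [div_le_one h4] at h3
        exact h3.trans ih
  by_contra! hlt
  have hc0 : 0 ≤ L (g ^ 2) := h g
  have step (k : ℕ) : L (a ^ k * g ^ 2) ^ 2 ≤ L (g ^ 2) * L (a ^ (2 * k) * g ^ 2) := by
    have h3 := cs L h g (a ^ k * g)
    have e1 : g * (a ^ k * g) = a ^ k * g ^ 2 := by ring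
    have e2 : (a ^ k * g) ^ 2 = a ^ (2 * k) * g ^ 2 := by ring
    rwa [e1, e2] at h3
  have hpos : 0 < L (g ^ 2) := by
    rcases hc0.lt_or_eq with h3 | h3
    · exact h3
    · exfalso
      have h4 := step 1
      rw [← h3, zero_mul, pow_one] at h4
      nlinarith
  set c := L (g ^ 2) with hc
  set r := L (a * g ^ 2) / c with hrdef
  have hr1 : 1 < r := (one_lt_div hpos).2 hlt
  have grow (k : ℕ) : c * r ^ (2 ^ k) ≤ L (a ^ (2 ^ k) * g ^ 2) := by
    induction k with
    | zero => simp only [pow_zero, pow_one, hrdef]; rw [mul_div_cancel₀ _ hpos.ne']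
    | succ k ih =>
      have h3 := step (2 ^ k)
      have h4 : (c * r ^ (2 ^ k)) ^ 2 ≤ L (a ^ (2 ^ k) * g ^ 2) ^ 2 :=
        pow_le_pow_left₀ (by positivity) ih 2
      have e : (c * r ^ (2 ^ k)) ^ 2 = c * (c * r ^ (2 ^ (k + 1))) := by ring
      rw [e] at h4
      rw [pow_succ' 2 k] at *
      exact le_of_mul_le_mul_left (h4.trans h3) hpos
  have bound (k : ℕ) : L (a ^ k * g ^ 2) ≤ L ((g ^ 2) ^ 2) + 1 := by
    have h3 := cs L h (a ^ k) (g ^ 2)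
    have e2 : (a ^ k) ^ 2 = a ^ (2 * k) := by ring
    rw [e2] at h3
    have h4 := h (g ^ 2)
    have h5 := mul_le_mul_of_nonneg_right (hb k) h4
    apply le_of_sq_le_sq _ (by positivity)
    nlinarith
  obtain ⟨n, hn⟩ := pow_unbounded_of_one_lt ((L ((g ^ 2) ^ 2) + 1) / c) hr1
  rw [div_lt_iff₀ hpos] at hn
  have h6 : r ^ n ≤ r ^ (2 ^ n) := pow_le_pow_right₀ hr1.le Nat.lt_two_pow_self.le
  have := mul_le_mul_of_nonneg_left h6 hpos.le
  linarith [grow n, bound (2 ^ n)]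

theorem isCompact_ball (s : ℕ) : IsCompact {x : Fin s → ℝ | ∑ i, x i ^ 2 ≤ 1} := by
  refine IsCompact.of_isClosed_subset
    (isCompact_univ_pi (s := fun _ => Set.Icc (-1 : ℝ) 1) fun p => isCompact_Icc)
    (isClosed_le (by fun_prop) continuous_const) ?_
  intro x hx i _
  have h1 : x i ^ 2 ≤ ∑ i, x i ^ 2 :=
    Finset.single_le_sum (f := fun i => x i ^ 2) (fun j _ => sq_nonneg _) (Finset.mem_univ i)
  refine abs_le.1 ?_
  apply abs_le_of_sq_le_sq _ zero_le_one
  simpa using h1.trans hx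

/-- Polynomials as continuous functions on a set. -/
noncomputable def toCont (K : Set (Fin s → ℝ)) : MvPolynomial (Fin s) ℝ →ₗ[ℝ] C(K, ℝ) where
  toFun P := ⟨fun x => eval (x : Fin s → ℝ) P, by
    exact (MvPolynomial.continuous_eval P).comp continuous_subtype_val⟩
  map_add' p q := by ext x; simp
  map_smul' c p := by ext x; simp

theorem exists_measure (K : Set (Fin s → ℝ)) (hK : IsCompact K)
    (L : MvPolynomial (Fin s) ℝ →ₗ[ℝ] ℝ)
    (hL : ∀ P, (∀ x ∈ K, 0 ≤ eval x P) → 0 ≤ L P) :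
    ∃ μ : Measure K, IsFiniteMeasure μ ∧
      ∀ P : MvPolynomial (Fin s) ℝ, L P = ∫ x, eval (x : Fin s → ℝ) P ∂μ := by
  have : CompactSpace K := isCompact_iff_compactSpace.1 hK
  have hker : LinearMap.ker (toCont K) ≤ LinearMap.ker L := by
    intro P hP
    rw [LinearMap.mem_ker] at hP ⊢
    have h0 : ∀ x ∈ K, eval x P = 0 := fun x hx => DFunLike.congr_fun hP (⟨x, hx⟩ : K)
    have h1 := hL P fun x hx => (h0 x hx).ge
    have h2 := hL (-P) fun x hx => by rw [map_neg, h0 x hx, neg_zero]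
    rw [map_neg] at h2
    linarith
  let F : C(K, ℝ) →ₗ.[ℝ] ℝ :=
    { domain := LinearMap.range (toCont K)
      toFun := (LinearMap.ker (toCont K)).liftQ L hker ∘ₗ
        (toCont K).quotKerEquivRange.symm.toLinearMap }
  have hF (P : MvPolynomial (Fin s) ℝ) : F ⟨toCont K P, P, rfl⟩ = L P := by
    show (LinearMap.ker (toCont K)).liftQ L hker
      ((toCont K).quotKerEquivRange.symm ⟨toCont K P, P, rfl⟩) = L P
    have : (toCont K).quotKerEquivRange.symm ⟨toCont K P, P, rfl⟩ =
        (LinearMap.ker (toCont K)).mkQ P := by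
      rw [LinearEquiv.symm_apply_eq]; rfl
    rw [this]; rfl
  let cone : PointedCone ℝ C(K, ℝ) :=
    { carrier := {f | ∀ x, 0 ≤ f x}
      add_mem' := fun {a b} ha hb x => add_nonneg (ha x) (hb x)
      zero_mem' := fun x => le_rfl
      smul_mem' := fun c f hf x => mul_nonneg c.2 (hf x) }
  obtain ⟨g, hg1, hg2⟩ := riesz_extension cone F
    (by
      rintro ⟨_, P, rfl⟩ hx
      rw [hF]
      exact hL P fun x hxK => hx ⟨x, hxK⟩)
    (by
      intro y
      refine ⟨⟨toCont K (C ‖y‖), _, rfl⟩, fun x => ?_⟩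
      have h1 := (abs_le.1 (y.norm_coe_le_norm x)).1
      show 0 ≤ eval (x : Fin s → ℝ) (C ‖y‖) + y x
      rw [eval_C]
      linarith)
  let Λ₀ : CompactlySupportedContinuousMap K ℝ →ₗ[ℝ] ℝ :=
    { toFun := fun f => g f.toContinuousMap
      map_add' := fun f h => g.map_add f.toContinuousMap h.toContinuousMap
      map_smul' := fun c f => g.map_smul c f.toContinuousMap }
  let Λ : CompactlySupportedContinuousMap K ℝ →ₚ[ℝ] ℝ :=
    PositiveLinearMap.mk₀ Λ₀ (fun f hf => hg2 _ fun x => hf x)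
  refine ⟨RealRMK.rieszMeasure Λ, inferInstance, fun P => ?_⟩
  have h1 := RealRMK.integral_rieszMeasure Λ
    (CompactlySupportedContinuousMap.continuousMapEquiv (toCont K P))
  have h2 : Λ (CompactlySupportedContinuousMap.continuousMapEquiv (toCont K P)) = L P :=
    (hg1 ⟨toCont K P, P, rfl⟩).trans (hF P)
  rw [← h2, ← h1]
  rfl

end BallMoment

theorem stmt17 (s : ℕ) (L : MvPolynomial (Fin s) ℝ →ₗ[ℝ] ℝ) (h1 : L 1 = 1) :
    (∃ μ : Measure ({x : Fin s → ℝ | ∑ i, x i ^ 2 ≤ 1} : Set (Fin s → ℝ)),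
        IsFiniteMeasure μ ∧
        ∀ P : MvPolynomial (Fin s) ℝ, L P = ∫ x, MvPolynomial.eval (x : Fin s → ℝ) P ∂μ) ↔
    ((∀ P : MvPolynomial (Fin s) ℝ, 0 ≤ L (P ^ 2)) ∧
      ∀ r ∈ ratioSet L (∑ i, X i ^ 2), r ≤ 1) := by
  constructor
  · rintro ⟨μ, hμ, hL⟩
    have hpsd : ∀ P : MvPolynomial (Fin s) ℝ, 0 ≤ L (P ^ 2) := by
      intro P
      rw [hL]
      exact integral_nonneg fun x => by simp only [map_pow]; exact sq_nonneg _
    refine ⟨hpsd, ?_⟩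
    rintro r ⟨n, -, rfl⟩
    have hcs : CompactSpace ({x : Fin s → ℝ | ∑ i, x i ^ 2 ≤ 1} : Set (Fin s → ℝ)) :=
      isCompact_iff_compactSpace.1 (BallMoment.isCompact_ball s)
    have hint (P : MvPolynomial (Fin s) ℝ) : Integrable
        (fun x : ({x : Fin s → ℝ | ∑ i, x i ^ 2 ≤ 1} : Set (Fin s → ℝ)) =>
          eval (x : Fin s → ℝ) P) μ :=
      ((MvPolynomial.continuous_eval P).comp continuous_subtype_val).integrable_of_hasCompactSupport
        (HasCompactSupport.of_compactSpace _)
    apply div_le_one_of_le₀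
    · rw [hL, hL]
      refine integral_mono (hint _) (hint _) fun x => ?_
      have hx : ∑ i, (x : Fin s → ℝ) i ^ 2 ≤ 1 := x.2
      have hx0 : 0 ≤ ∑ i, (x : Fin s → ℝ) i ^ 2 := Finset.sum_nonneg fun i _ => sq_nonneg _
      simp only [map_pow, map_sum, eval_X]
      exact pow_le_pow_of_le_one hx0 hx (by omega)
    · rw [mul_comm, pow_mul]; exact hpsd _
  · rintro ⟨h, hr⟩
    have hq : BallMoment.QPos L := BallMoment.qpos_of_ratio h1 h hr
    exact BallMoment.exists_measure _ (BallMoment.isCompact_ball s) L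
      fun P hP => BallMoment.nonneg_of_qpos hq h1 P hP
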